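/- Let f be a probability density function on ℝ that is positive everywhere, strictly log-concave, and has a finite mean, and let b ∈ ℝ. For N ≥ 1 let m_1^{(N)} < ⋯ < m_{N−1}^{(N)} be the unique N-bin equilibrium edges (with m_0 = −∞, m_N = +∞) and u_1^{(N)}, …, u_N^{(N)} the corresponding centroids, and define the decoder's equilibrium cost J^d(N) = Σ_{k=1}^{N} ∫_{m_{k−1}^{(N)}}^{m_k^{(N)}} (u_k^{(N)} − x)² f(x) dx. Then J^d(N+1) < J^d(N) for every N ≥ 1; i.e., an equilibrium with more bins is strictly more informative (it also yields strictly smaller encoder cost, since the encoder cost equals J^d + b²). -/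

import Mathlib

open MeasureTheory Set

/-- Conditional mean `E[M | M ∈ s]` of a random variable with density `f`. -/
noncomputable def condMean (f : ℝ → ℝ) (s : Set ℝ) : ℝ :=
  (∫ x in s, x * f x) / (∫ x in s, f x)

/-- The bin (interval) of real numbers between two extended-real edges `lo` and `hi`. -/
def ebin (lo hi : EReal) : Set ℝ := {x : ℝ | lo ≤ (x : EReal) ∧ (x : EReal) < hi}

/-- Edges `m_0 = −∞ < m_1 < ⋯ < m_{N−1} < m_N = +∞` of an `N`-bin quantizer with interior
edges `m : Fin (N−1) → ℝ`, for a source with two-sided unbounded support. -/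
noncomputable def edges2 (N : ℕ) (m : Fin (N - 1) → ℝ) (k : ℕ) : EReal :=
  if hk : k = 0 then ⊥
  else if h : k ≤ N - 1 then ((m ⟨k - 1, by omega⟩ : ℝ) : EReal)
  else ⊤

/-- `N`-bin cheap-talk equilibrium for a source with density `f` on `ℝ` and bias `b`. -/
def IsEq2 (f : ℝ → ℝ) (b : ℝ) (N : ℕ) (m : Fin (N - 1) → ℝ) : Prop :=
  StrictMono m ∧ ∀ k : Fin (N - 1),
    m k = (condMean f (ebin (edges2 N m k.val) (edges2 N m (k.val + 1)))
         + condMean f (ebin (edges2 N m (k.val + 1)) (edges2 N m (k.val + 2)))) / 2 + b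

/-- The decoder's cost `J^d = Σ_k ∫_{bin k} (u_k − x)² f(x) dx` of the `N`-bin quantizer
with interior edges `m`, where `u_k` is the centroid of bin `k`. -/
noncomputable def decoderCost (f : ℝ → ℝ) (N : ℕ) (m : Fin (N - 1) → ℝ) : ℝ :=
  ∑ k : Fin N, ∫ x in ebin (edges2 N m k.val) (edges2 N m (k.val + 1)),
    (condMean f (ebin (edges2 N m k.val) (edges2 N m (k.val + 1))) - x) ^ 2 * f x

/-- The Lebesgue integral of `g` over the real numbers below the extended-real threshold `z`. -/
noncomputable def integralBelow (g : ℝ → ℝ) (z : EReal) : ℝ := ∫ y in {y : ℝ | (y : EReal) < z}, g y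

lemma measurableSet_ebin (lo hi : EReal) : MeasurableSet (ebin lo hi) :=
  (measurableSet_le measurable_const measurable_coe_real_ereal).inter
    (measurableSet_lt measurable_coe_real_ereal measurable_const)

lemma setIntegral_ebin {g : ℝ → ℝ} (hg : Integrable g) {lo hi : EReal} (h : lo ≤ hi) :
    ∫ x in ebin lo hi, g x = integralBelow g hi - integralBelow g lo := by
  have hu : {y : ℝ | (y : EReal) < hi} = {y : ℝ | (y : EReal) < lo} ∪ ebin lo hi := by
    ext y
    simp only [mem_ofPred_eq, mem_union, ebin]
    constructor
    · intro hy
      rcases lt_or_ge (y : EReal) lo with h1 | h1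
      · exact Or.inl h1
      · exact Or.inr ⟨h1, hy⟩
    · rintro (h1 | h1)
      · exact h1.trans_le h
      · exact h1.2
  have hd : Disjoint {y : ℝ | (y : EReal) < lo} (ebin lo hi) := by
    rw [Set.disjoint_left]
    intro y hy hy'
    exact absurd hy'.1 (not_le.2 hy)
  unfold integralBelow
  rw [hu, setIntegral_union hd (measurableSet_ebin lo hi) hg.integrableOn hg.integrableOn]
  ring

lemma setIntegral_ebin_add {g : ℝ → ℝ} (hg : Integrable g) {lo mid hi : EReal}
    (h : lo ≤ mid) (h' : mid ≤ hi) :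
    ∫ x in ebin lo hi, g x = (∫ x in ebin lo mid, g x) + ∫ x in ebin mid hi, g x := by
  rw [setIntegral_ebin hg h, setIntegral_ebin hg h', setIntegral_ebin hg (h.trans h')]
  ring

lemma continuous_integralBelow {g : ℝ → ℝ} (hg : Integrable g) :
    Continuous (fun z : ℝ => integralBelow g (z : EReal)) := by
  have : (fun z : ℝ => integralBelow g (z : EReal))
      = fun z => (∫ x in Iic (0 : ℝ), g x) + ∫ x in (0 : ℝ)..z, g x := by
    funext z
    have h := intervalIntegral.integral_Iic_sub_Iic (μ := volume) (f := g) (a := 0) (b := z)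
      hg.integrableOn hg.integrableOn
    have h2 : {y : ℝ | (y : EReal) < (z : EReal)} = Iio z := by
      ext y; simp
    rw [integralBelow, h2, ← integral_Iic_eq_integral_Iio]
    linarith
  rw [this]
  exact continuous_const.add
    (intervalIntegral.continuous_primitive (fun a b => hg.intervalIntegrable) 0)

lemma integralBelow_bot (g : ℝ → ℝ) : integralBelow g ⊥ = 0 := by
  simp [integralBelow]

lemma volume_ebin_pos {lo hi : EReal} (h : lo < hi) : 0 < volume (ebin lo hi) := by
  obtain ⟨a, h1, h2⟩ := EReal.lt_iff_exists_real_btwn.1 h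
  obtain ⟨c, h3, h4⟩ := EReal.lt_iff_exists_real_btwn.1 h2
  have hac : a < c := by exact_mod_cast h3
  have hs : Ioo a c ⊆ ebin lo hi := by
    intro x hx
    refine ⟨h1.le.trans ?_, lt_trans ?_ h4⟩
    · exact_mod_cast hx.1.le
    · exact_mod_cast hx.2
  refine lt_of_lt_of_le ?_ (measure_mono hs)
  simp [hac]

lemma setIntegral_ebin_pos {h : ℝ → ℝ} (hi' : Integrable h) {lo hi : EReal} (hlt : lo < hi)
    (c : ℝ) (hp : ∀ x ∈ ebin lo hi, x ≠ c → 0 < h x) : 0 < ∫ x in ebin lo hi, h x := by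
  have hc : ∀ᵐ x : ℝ, x ≠ c := by simp [ae_iff]
  have hpos : ∀ᵐ x ∂(volume.restrict (ebin lo hi)), 0 < h x := by
    rw [ae_restrict_iff' (measurableSet_ebin lo hi)]
    filter_upwards [hc] with x hx hxs using hp x hxs hx
  rw [setIntegral_pos_iff_support_of_nonneg_ae (hpos.mono fun x hx => hx.le) hi'.integrableOn]
  refine (volume_ebin_pos hlt).trans_le (measure_mono_ae ?_)
  have := (ae_restrict_iff' (measurableSet_ebin lo hi)).1 hpos
  filter_upwards [this] with x hx hxs
  exact ⟨(hx hxs).ne', hxs⟩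

lemma setIntegral_ebin_shift (g : ℝ → ℝ) (lo hi : EReal) (δ : ℝ) :
    ∫ x in ebin (lo + δ) (hi + δ), g x = ∫ x in ebin lo hi, g (x + δ) := by
  rw [← (measurePreserving_add_right volume δ).setIntegral_preimage_emb
    (measurableEmbedding_addRight δ) g]
  congr 2
  ext x
  have hδ : ((x + δ : ℝ) : EReal) = (x : EReal) + δ := EReal.coe_add x δ
  simp only [ebin, mem_preimage, mem_ofPred_eq, hδ]
  have key : ∀ p q : EReal, p + (δ : EReal) ≤ q + δ ↔ p ≤ q := by
    intro p q
    constructor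
    · intro h
      have := EReal.sub_le_sub h (le_refl (δ : EReal))
      rwa [EReal.add_sub_cancel_right, EReal.add_sub_cancel_right] at this
    · intro h
      exact add_le_add_left h _
  rw [key, ← not_le, key, not_le]

lemma setIntegral_ebin_neg (g : ℝ → ℝ) (lo hi : EReal) :
    ∫ x in ebin (-hi) (-lo), g x = ∫ x in ebin lo hi, g (-x) := by
  rw [← (Measure.measurePreserving_neg (volume : Measure ℝ)).setIntegral_preimage_emb
    (MeasurableEquiv.neg ℝ).measurableEmbedding g]
  refine setIntegral_congr_set ?_
  have h1 : ∀ᵐ x : ℝ, x ≠ lo.toReal := by simp [ae_iff]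
  have h2 : ∀ᵐ x : ℝ, x ≠ hi.toReal := by simp [ae_iff]
  filter_upwards [h1, h2] with x hx1 hx2
  have e1 : (x : EReal) ≠ lo := by rintro rfl; simp at hx1
  have e2 : (x : EReal) ≠ hi := by rintro rfl; simp at hx2
  change (x ∈ Neg.neg ⁻¹' ebin (-hi) (-lo)) = (x ∈ ebin lo hi)
  simp only [ebin, mem_preimage, mem_ofPred_eq, EReal.coe_neg, EReal.neg_le_neg_iff,
    EReal.neg_lt_neg_iff, eq_iff_iff]
  exact ⟨fun h => ⟨h.2.le, lt_of_le_of_ne h.1 e2⟩, fun h => ⟨h.2.le, lt_of_le_of_ne h.1 e1.symm⟩⟩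

/-- Everywhere positive, integrable, strictly log-concave functions with finite first moment. -/
structure IsLogConcaveDensity (f : ℝ → ℝ) : Prop where
  pos : ∀ x, 0 < f x
  integrable : Integrable f
  strictConcaveOn : StrictConcaveOn ℝ Set.univ (fun x => Real.log (f x))
  integrable_mul : Integrable (fun x => x * f x)

namespace IsLogConcaveDensity

variable {f : ℝ → ℝ}

lemma comp_neg (hf : IsLogConcaveDensity f) : IsLogConcaveDensity (fun x => f (-x)) where
  pos x := hf.pos _
  integrable := hf.integrable.comp_neg
  strictConcaveOn := by
    refine ⟨convex_univ, fun x _ y _ hxy a b ha hb hab => ?_⟩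
    have := hf.strictConcaveOn.2 (mem_univ (-x)) (mem_univ (-y)) (by simpa using hxy) ha hb hab
    have e : a • -x + b • -y = -(a • x + b • y) := by simp [smul_eq_mul]; ring
    rw [e] at this
    exact this
  integrable_mul := by
    refine hf.integrable_mul.comp_neg.neg.congr (Filter.Eventually.of_forall fun x => ?_)
    simp

lemma continuous (hf : IsLogConcaveDensity f) : Continuous f := by
  have h : ContinuousOn (fun x => Real.log (f x)) univ :=
    hf.strictConcaveOn.concaveOn.continuousOn isOpen_univ
  have h2 := Real.continuous_exp.comp (continuousOn_univ.1 h)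
  convert h2 using 1
  funext x
  simp [Real.exp_log (hf.pos x)]

lemma shift_ratio_anti (hf : IsLogConcaveDensity f) {x y δ : ℝ} (hxy : x < y) (hδ : 0 < δ) :
    f x * f (y + δ) < f (x + δ) * f y := by
  have hd : 0 < y - x + δ := by linarith
  have hne : x ≠ y + δ := by linarith
  have p1 : 0 < (y - x) / (y - x + δ) := div_pos (by linarith) hd
  have p2 : 0 < δ / (y - x + δ) := div_pos hδ hd
  have e3 : (y - x) / (y - x + δ) + δ / (y - x + δ) = 1 := by field_simp
  have h1 := hf.strictConcaveOn.2 (mem_univ x) (mem_univ (y + δ)) hne p1 p2 e3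
  have h2 := hf.strictConcaveOn.2 (mem_univ x) (mem_univ (y + δ)) hne p2 p1
    (by rw [add_comm]; exact e3)
  have e1 : ((y - x) / (y - x + δ)) • x + (δ / (y - x + δ)) • (y + δ) = x + δ := by
    simp only [smul_eq_mul]; field_simp; ring
  have e2 : (δ / (y - x + δ)) • x + ((y - x) / (y - x + δ)) • (y + δ) = y := by
    simp only [smul_eq_mul]; field_simp; ring
  rw [e1] at h1
  rw [e2] at h2
  simp only [smul_eq_mul] at h1 h2
  have h3 : Real.log (f x) + Real.log (f (y + δ)) < Real.log (f (x + δ)) + Real.log (f y) := by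
    have e4 : Real.log (f x) + Real.log (f (y + δ)) =
        ((y - x) / (y - x + δ) * Real.log (f x) + δ / (y - x + δ) * Real.log (f (y + δ))) +
        (δ / (y - x + δ) * Real.log (f x) + (y - x) / (y - x + δ) * Real.log (f (y + δ))) := by
      linear_combination -(Real.log (f x) + Real.log (f (y + δ))) * e3
    rw [e4]
    exact add_lt_add h1 h2
  rw [← Real.log_mul (hf.pos _).ne' (hf.pos _).ne',
    ← Real.log_mul (hf.pos _).ne' (hf.pos _).ne'] at h3
  exact (Real.log_lt_log_iff (mul_pos (hf.pos _) (hf.pos _)) (mul_pos (hf.pos _) (hf.pos _))).1 h3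

lemma exists_gt_lt (hf : IsLogConcaveDensity f) : ∃ x y, x < y ∧ f y < f x := by
  by_contra! h
  have hsub : Ici (0 : ℝ) ⊆ {x | f 0 ≤ ‖f x‖} := by
    intro x hx
    rcases (mem_Ici.1 hx).eq_or_lt with rfl | h0
    · exact Real.le_norm_self (f 0)
    · exact (h 0 x h0).trans (Real.le_norm_self _)
  have h1 := hf.integrable.measure_norm_ge_lt_top (hf.pos 0)
  have h2 := (measure_mono hsub).trans_lt h1
  simp at h2

lemma isBigO_exp_neg (hf : IsLogConcaveDensity f) :
    ∃ α > 0, f =O[Filter.atTop] fun x => Real.exp (-α * x) := by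
  obtain ⟨x, y, hxy, hlt⟩ := hf.exists_gt_lt
  have hl : Real.log (f y) < Real.log (f x) := Real.log_lt_log (hf.pos _) hlt
  have hd : 0 < y - x := by linarith
  set α := (Real.log (f x) - Real.log (f y)) / (y - x) with hα
  have hα0 : 0 < α := div_pos (by linarith) hd
  refine ⟨α, hα0, Asymptotics.IsBigO.of_bound (Real.exp (Real.log (f y) + α * y)) ?_⟩
  filter_upwards [Filter.eventually_gt_atTop y] with z hz
  rw [Real.norm_of_nonneg (hf.pos z).le, Real.norm_of_nonneg (Real.exp_pos _).le, ← Real.exp_add]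
  rw [← Real.exp_log (hf.pos z)]
  apply Real.exp_le_exp.2
  have hs := hf.strictConcaveOn.concaveOn.slope_anti_adjacent (mem_univ x) (mem_univ z) hxy hz
  rw [div_le_iff₀ (by linarith)] at hs
  have e : (Real.log (f y) - Real.log (f x)) / (y - x) = -α := by rw [hα]; ring
  rw [e] at hs
  linarith

lemma integrableOn_sq_mul_Ioi (hf : IsLogConcaveDensity f) :
    IntegrableOn (fun x => x ^ 2 * f x) (Ioi 0) := by
  obtain ⟨α, hα, hO⟩ := hf.isBigO_exp_neg
  refine integrable_of_isBigO_exp_neg (b := α / 2) (by linarith)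
    ((continuous_pow 2).mul hf.continuous).continuousOn ?_
  have h1 : (fun x : ℝ => x ^ 2) =O[Filter.atTop] fun x => Real.exp (α / 2 * x) :=
    (isLittleO_pow_exp_pos_mul_atTop 2 (by linarith : 0 < α / 2)).isBigO
  refine (h1.mul hO).congr_right fun x => ?_
  rw [← Real.exp_add]
  congr 1
  ring

lemma integrable_sq_mul (hf : IsLogConcaveDensity f) : Integrable (fun x => x ^ 2 * f x) := by
  have h1 := hf.integrableOn_sq_mul_Ioi
  have h2 := (integrableOn_Ici_iff_integrableOn_Ioi).2 hf.comp_neg.integrableOn_sq_mul_Ioi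
  have h3 : IntegrableOn (fun x => x ^ 2 * f x) (Iic 0) := by
    have h4 := (Measure.measurePreserving_neg (volume : Measure ℝ)).integrableOn_comp_preimage
      (MeasurableEquiv.neg ℝ).measurableEmbedding (f := fun x => x ^ 2 * f x) (s := Iic 0)
    refine h4.1 ?_
    have e : (Neg.neg ⁻¹' Iic (0 : ℝ)) = Ici 0 := by ext; simp
    rw [e]
    refine h2.congr_fun (fun x _ => ?_) measurableSet_Ici
    simp
  rw [← integrableOn_univ, ← Iic_union_Ioi (a := (0 : ℝ))]
  exact h3.union h1

lemma integrable_sub_mul (hf : IsLogConcaveDensity f) (w : ℝ) :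
    Integrable (fun x => (x - w) * f x) := by
  refine (hf.integrable_mul.sub (hf.integrable.const_mul w)).congr
    (Filter.Eventually.of_forall fun x => ?_)
  simp only [Pi.sub_apply]
  ring

lemma integrable_sub_sq_mul (hf : IsLogConcaveDensity f) (w : ℝ) :
    Integrable (fun x => (w - x) ^ 2 * f x) := by
  refine ((hf.integrable_sq_mul.sub (hf.integrable_mul.const_mul (2 * w))).add
    (hf.integrable.const_mul (w ^ 2))).congr (Filter.Eventually.of_forall fun x => ?_)
  simp only [Pi.sub_apply, Pi.add_apply]
  ring

lemma mass_pos (hf : IsLogConcaveDensity f) {lo hi : EReal} (h : lo < hi) :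
    0 < ∫ x in ebin lo hi, f x :=
  setIntegral_ebin_pos hf.integrable h 0 fun x _ _ => hf.pos x

lemma setIntegral_sub_mul (hf : IsLogConcaveDensity f) {lo hi : EReal} (h : lo < hi) (w : ℝ) :
    ∫ x in ebin lo hi, (x - w) * f x
      = (condMean f (ebin lo hi) - w) * ∫ x in ebin lo hi, f x := by
  have h1 : ∫ x in ebin lo hi, (x - w) * f x
      = (∫ x in ebin lo hi, x * f x) - w * ∫ x in ebin lo hi, f x := by
    rw [← integral_const_mul, ← integral_sub hf.integrable_mul.integrableOn
      (hf.integrable.const_mul w).integrableOn]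
    congr 1
    funext x
    ring
  have := (hf.mass_pos h).ne'
  rw [h1, condMean]
  field_simp

lemma setIntegral_sub_sq_mul (hf : IsLogConcaveDensity f) {lo hi : EReal} (h : lo < hi) (w : ℝ) :
    ∫ x in ebin lo hi, (w - x) ^ 2 * f x
      = (∫ x in ebin lo hi, (condMean f (ebin lo hi) - x) ^ 2 * f x)
        + (condMean f (ebin lo hi) - w) ^ 2 * ∫ x in ebin lo hi, f x := by
  set c := condMean f (ebin lo hi) with hc
  have h0 := hf.setIntegral_sub_mul h c
  rw [← hc, sub_self, zero_mul] at h0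
  have h1 : ∫ x in ebin lo hi, (w - x) ^ 2 * f x
      = ∫ x in ebin lo hi, (((c - x) ^ 2 * f x + (2 * (c - w)) * ((x - c) * f x))
        + (c - w) ^ 2 * f x) := by
    congr 1
    funext x
    ring
  rw [h1, integral_add, integral_add, integral_const_mul, integral_const_mul, h0]
  · ring
  · exact (hf.integrable_sub_sq_mul c).integrableOn
  · exact ((hf.integrable_sub_mul c).const_mul _).integrableOn
  · exact ((hf.integrable_sub_sq_mul c).add ((hf.integrable_sub_mul c).const_mul _)).integrableOn
  · exact (hf.integrable.const_mul _).integrableOn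

lemma condMean_lt (hf : IsLogConcaveDensity f) {lo : EReal} {hi : ℝ} (h : lo < hi) :
    condMean f (ebin lo hi) < hi := by
  have h1 := hf.setIntegral_sub_mul h hi
  have h2 : 0 < ∫ x in ebin lo hi, -((x - hi) * f x) := by
    refine setIntegral_ebin_pos (hf.integrable_sub_mul hi).neg h hi fun x hx hne => ?_
    simp only [Pi.neg_apply]
    have : x < hi := by exact_mod_cast hx.2
    nlinarith [hf.pos x]
  rw [integral_neg, h1] at h2
  nlinarith [hf.mass_pos h]

lemma lt_condMean (hf : IsLogConcaveDensity f) {lo : ℝ} {hi : EReal} (h : lo < hi) :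
    lo < condMean f (ebin lo hi) := by
  have h1 := hf.setIntegral_sub_mul h lo
  have h2 : 0 < ∫ x in ebin lo hi, ((x - lo) * f x) := by
    refine setIntegral_ebin_pos (hf.integrable_sub_mul lo) h lo fun x hx hne => ?_
    have : lo ≤ x := by exact_mod_cast hx.1
    exact mul_pos (sub_pos.2 (lt_of_le_of_ne this hne.symm)) (hf.pos x)
  rw [h1] at h2
  exact sub_pos.1 (pos_of_mul_pos_left h2 (hf.mass_pos h).le)

lemma condMean_le_ereal (hf : IsLogConcaveDensity f) {lo hi : EReal} (h : lo < hi) :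
    (condMean f (ebin lo hi) : EReal) ≤ hi := by
  induction hi with
  | bot => exact absurd h not_lt_bot
  | top => exact le_top
  | coe z => exact_mod_cast (hf.condMean_lt h).le

lemma le_condMean_ereal (hf : IsLogConcaveDensity f) {lo hi : EReal} (h : lo < hi) :
    lo ≤ (condMean f (ebin lo hi) : EReal) := by
  induction lo with
  | bot => exact bot_le
  | top => exact absurd h not_top_lt
  | coe z => exact_mod_cast (hf.lt_condMean h).le

lemma condMean_mono (hf : IsLogConcaveDensity f) {lo hi lo' hi' : EReal} (h : lo < hi)
    (h' : lo' < hi') (hl : lo ≤ lo') (hh : hi ≤ hi') :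
    condMean f (ebin lo hi) ≤ condMean f (ebin lo' hi') := by
  have h3 : lo < hi' := h.trans_le hh
  have m := hf.mass_pos h3
  trans condMean f (ebin lo hi')
  · have h1 := hf.setIntegral_sub_mul h3 (condMean f (ebin lo hi))
    rw [setIntegral_ebin_add (hf.integrable_sub_mul _) h.le hh, hf.setIntegral_sub_mul h,
      sub_self, zero_mul, zero_add] at h1
    have h2 : 0 ≤ ∫ x in ebin hi hi', (x - condMean f (ebin lo hi)) * f x := by
      refine setIntegral_nonneg (measurableSet_ebin _ _) fun x hx => ?_
      have : condMean f (ebin lo hi) ≤ x := by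
        exact_mod_cast (hf.condMean_le_ereal h).trans hx.1
      exact mul_nonneg (by linarith) (hf.pos x).le
    rw [h1] at h2
    exact sub_nonneg.1 (nonneg_of_mul_nonneg_left h2 m)
  · have h1 := hf.setIntegral_sub_mul h3 (condMean f (ebin lo' hi'))
    rw [setIntegral_ebin_add (hf.integrable_sub_mul _) hl h'.le, hf.setIntegral_sub_mul h',
      sub_self, zero_mul, add_zero] at h1
    have h2 : ∫ x in ebin lo lo', (x - condMean f (ebin lo' hi')) * f x ≤ 0 := by
      refine setIntegral_nonpos (measurableSet_ebin _ _) fun x hx => ?_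
      have : x ≤ condMean f (ebin lo' hi') := by
        exact_mod_cast hx.2.le.trans (hf.le_condMean_ereal h')
      exact mul_nonpos_of_nonpos_of_nonneg (by linarith) (hf.pos x).le
    rw [h1] at h2
    nlinarith

lemma condMean_shift_lt (hf : IsLogConcaveDensity f) {lo hi : EReal} (h : lo < hi) {δ : ℝ}
    (hδ : 0 < δ) :
    condMean f (ebin (lo + δ) (hi + δ)) < condMean f (ebin lo hi) + δ := by
  set u := condMean f (ebin lo hi) with hu
  have i1 : Integrable (fun x => f (x + δ)) := hf.integrable.comp_add_right δ
  have i2 : Integrable (fun x => (x - u) * f (x + δ)) := by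
    refine ((hf.integrable_sub_mul (u + δ)).comp_add_right δ).congr
      (Filter.Eventually.of_forall fun x => ?_)
    simp
  have m : 0 < ∫ x in ebin lo hi, f (x + δ) :=
    setIntegral_ebin_pos i1 h 0 fun x _ _ => hf.pos _
  have h1 : 0 < ∫ x in ebin lo hi,
      (f (u + δ) * ((x - u) * f x) - f u * ((x - u) * f (x + δ))) := by
    refine setIntegral_ebin_pos (((hf.integrable_sub_mul u).const_mul _).sub (i2.const_mul _))
      h u fun x _ hne => ?_
    simp only [Pi.sub_apply]
    rcases lt_or_gt_of_ne hne with hx | hx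
    · nlinarith [hf.shift_ratio_anti hx hδ]
    · nlinarith [hf.shift_ratio_anti hx hδ]
  rw [integral_sub ((hf.integrable_sub_mul u).const_mul _).integrableOn
    (i2.const_mul _).integrableOn, integral_const_mul, integral_const_mul,
    hf.setIntegral_sub_mul h, ← hu, sub_self, zero_mul, mul_zero, zero_sub] at h1
  have h2 : ∫ x in ebin lo hi, (x - u) * f (x + δ) < 0 := by
    nlinarith [hf.pos u]
  have h3 : ∫ x in ebin lo hi, (x + δ) * f (x + δ)
      = (∫ x in ebin lo hi, (x - u) * f (x + δ)) + (u + δ) * ∫ x in ebin lo hi, f (x + δ) := by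
    rw [← integral_const_mul, ← integral_add i2.integrableOn (i1.const_mul _).integrableOn]
    congr 1
    funext x
    ring
  rw [condMean, setIntegral_ebin_shift f, setIntegral_ebin_shift (fun x => x * f x), h3,
    div_lt_iff₀ m]
  linarith

end IsLogConcaveDensity

/-- Edges of the `(n + 1)`-bin quantizer with interior edges `e`. -/
noncomputable abbrev binEdge {n : ℕ} (e : Fin n → ℝ) (k : ℕ) : EReal := edges2 (n + 1) e k

/-- Centroid of the `k`-th bin of the quantizer with interior edges `e`. -/
noncomputable def centroid (f : ℝ → ℝ) {n : ℕ} (e : Fin n → ℝ) (k : ℕ) : ℝ :=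
  condMean f (ebin (binEdge e k) (binEdge e (k + 1)))

/-- Nearest-neighbor edges of an encoder with bias `b` facing the centroids of `e`. -/
noncomputable def bestEdges (f : ℝ → ℝ) (b : ℝ) {n : ℕ} (e : Fin n → ℝ) (k : Fin n) : ℝ :=
  (centroid f e k + centroid f e (k + 1)) / 2 + b

/-- Mean squared error of the quantizer with interior edges `e` and receiver actions `u`. -/
noncomputable def actionCost (f : ℝ → ℝ) {n : ℕ} (e : Fin n → ℝ) (u : ℕ → ℝ) : ℝ :=
  ∑ k ∈ Finset.range (n + 1), ∫ x in ebin (binEdge e k) (binEdge e (k + 1)), (u k - x) ^ 2 * f x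

section Edges

variable {n : ℕ} (e : Fin n → ℝ)

lemma binEdge_zero : binEdge e 0 = ⊥ := by simp [binEdge, edges2]

lemma binEdge_succ (k : Fin n) : binEdge e (k + 1) = e k := by
  have : (k : ℕ) + 1 ≤ n + 1 - 1 := by omega
  simp [binEdge, edges2]

lemma binEdge_of_gt {k : ℕ} (hk : n < k) : binEdge e k = ⊤ := by
  have h1 : ¬ k ≤ n + 1 - 1 := by omega
  have h2 : k ≠ 0 := by omega
  simp only [binEdge, edges2, h1, h2, dite_false]

lemma binEdge_cases {p : ℕ → EReal → Prop} (h0 : p 0 ⊥) (h1 : ∀ k : Fin n, p (k + 1) (e k))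
    (h2 : ∀ k, n < k → p k ⊤) (k : ℕ) : p k (binEdge e k) := by
  rcases k with _ | k
  · rwa [binEdge_zero]
  · by_cases hk : k < n
    · have := binEdge_succ e ⟨k, hk⟩
      simp only at this
      rw [this]
      exact h1 ⟨k, hk⟩
    · rw [binEdge_of_gt e (by omega)]
      exact h2 _ (by omega)

variable {e}

lemma binEdge_lt_succ (he : StrictMono e) {k : ℕ} (hk : k ≤ n) :
    binEdge e k < binEdge e (k + 1) := by
  rcases k with _ | k
  · rw [binEdge_zero]
    rcases Nat.eq_zero_or_pos n with h | h
    · rw [binEdge_of_gt e (by omega)]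
      exact bot_lt_top
    · have := binEdge_succ e ⟨0, h⟩
      simp only at this
      rw [this]
      exact EReal.bot_lt_coe _
  · have h1 := binEdge_succ e ⟨k, hk⟩
    simp only at h1
    rw [h1]
    rcases Nat.lt_or_ge (k + 1) n with h | h
    · have h2 := binEdge_succ e ⟨k + 1, h⟩
      simp only at h2
      rw [h2]
      exact_mod_cast he (by simp)
    · rw [binEdge_of_gt e (by omega)]
      exact EReal.coe_lt_top _

lemma binEdge_mono_le {e' : Fin n → ℝ} (h : e ≤ e') (k : ℕ) : binEdge e k ≤ binEdge e' k := by
  refine binEdge_cases e (p := fun k z => z ≤ binEdge e' k) bot_le (fun k => ?_) (fun k hk => ?_) k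
  · rw [binEdge_succ]
    exact_mod_cast h k
  · rw [binEdge_of_gt e' hk]

lemma binEdge_le_add {e' : Fin n → ℝ} {δ : ℝ} (h : ∀ k, e k ≤ e' k + δ) (k : ℕ) :
    binEdge e k ≤ binEdge e' k + δ := by
  refine binEdge_cases e (p := fun k z => z ≤ binEdge e' k + δ) bot_le (fun k => ?_)
    (fun k hk => ?_) k
  · rw [binEdge_succ]
    exact_mod_cast h k
  · rw [binEdge_of_gt e' hk, EReal.top_add_coe]

lemma tendsto_integralBelow_binEdge {g : ℝ → ℝ} (hg : Integrable g) {s : ℕ → Fin n → ℝ}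
    (h : ∀ k, Filter.Tendsto (fun j => s j k) Filter.atTop (nhds (e k))) (k : ℕ) :
    Filter.Tendsto (fun j => integralBelow g (binEdge (s j) k)) Filter.atTop
      (nhds (integralBelow g (binEdge e k))) := by
  refine binEdge_cases e (p := fun k z => Filter.Tendsto
    (fun j => integralBelow g (binEdge (s j) k)) Filter.atTop (nhds (integralBelow g z)))
    ?_ (fun k => ?_) (fun k hk => ?_) k
  · simp only [binEdge_zero]
    exact tendsto_const_nhds
  · simp only [binEdge_succ]
    exact ((continuous_integralBelow hg).tendsto (e k)).comp (h k)
  · simp only [binEdge_of_gt _ hk]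
    exact tendsto_const_nhds

lemma tendsto_setIntegral_binEdge {g : ℝ → ℝ} (hg : Integrable g) {s : ℕ → Fin n → ℝ}
    (h : ∀ k, Filter.Tendsto (fun j => s j k) Filter.atTop (nhds (e k)))
    (hs : ∀ j, StrictMono (s j)) {k : ℕ} (hk : k ≤ n)
    (hlt : binEdge e k ≤ binEdge e (k + 1)) :
    Filter.Tendsto (fun j => ∫ x in ebin (binEdge (s j) k) (binEdge (s j) (k + 1)), g x)
      Filter.atTop (nhds (∫ x in ebin (binEdge e k) (binEdge e (k + 1)), g x)) := by
  rw [setIntegral_ebin hg hlt]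
  simp only [fun j => setIntegral_ebin hg (binEdge_lt_succ (hs j) hk).le]
  exact (tendsto_integralBelow_binEdge hg h _).sub (tendsto_integralBelow_binEdge hg h _)

end Edges

lemma decoderCost_eq_actionCost (f : ℝ → ℝ) {n : ℕ} (e : Fin n → ℝ) :
    decoderCost f (n + 1) e = actionCost f e (centroid f e) :=
  Fin.sum_univ_eq_sum_range (fun k => ∫ x in ebin (binEdge e k) (binEdge e (k + 1)),
    (centroid f e k - x) ^ 2 * f x) (n + 1)

lemma isEq2_succ_iff {f : ℝ → ℝ} {b : ℝ} {n : ℕ} {e : Fin n → ℝ} :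
    IsEq2 f b (n + 1) e ↔ StrictMono e ∧ ∀ k, e k = bestEdges f b e k :=
  Iff.rfl

namespace IsLogConcaveDensity

variable {f : ℝ → ℝ} {b : ℝ} {n : ℕ} {e e' : Fin n → ℝ}

lemma centroid_lt_edge (hf : IsLogConcaveDensity f) (he : StrictMono e) (k : Fin n) :
    centroid f e k < e k := by
  have h := binEdge_lt_succ he k.2.le
  rw [binEdge_succ] at h
  rw [centroid, binEdge_succ]
  exact hf.condMean_lt h

lemma edge_lt_centroid (hf : IsLogConcaveDensity f) (he : StrictMono e) (k : Fin n) :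
    e k < centroid f e (k + 1) := by
  have h := binEdge_lt_succ he (Nat.succ_le_of_lt k.2)
  rw [Nat.succ_eq_add_one, binEdge_succ] at h
  rw [centroid, binEdge_succ]
  exact hf.lt_condMean h

lemma centroid_lt_succ (hf : IsLogConcaveDensity f) (he : StrictMono e) {k : ℕ} (hk : k < n) :
    centroid f e k < centroid f e (k + 1) :=
  (hf.centroid_lt_edge he ⟨k, hk⟩).trans (hf.edge_lt_centroid he ⟨k, hk⟩)

lemma strictMono_bestEdges (hf : IsLogConcaveDensity f) (he : StrictMono e) :
    StrictMono (bestEdges f b e) := by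
  rcases n with _ | n
  · exact fun i => i.elim0
  refine Fin.strictMono_iff_lt_succ.2 fun i => ?_
  have h1 := hf.centroid_lt_succ he (k := i) (by omega)
  have h2 := hf.centroid_lt_succ he (k := i + 1) (by omega)
  simp only [bestEdges, Fin.val_castSucc, Fin.val_succ]
  linarith

lemma centroid_mono (hf : IsLogConcaveDensity f) (he : StrictMono e) (he' : StrictMono e')
    (h : e ≤ e') {k : ℕ} (hk : k ≤ n) : centroid f e k ≤ centroid f e' k :=
  hf.condMean_mono (binEdge_lt_succ he hk) (binEdge_lt_succ he' hk) (binEdge_mono_le h _)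
    (binEdge_mono_le h _)

lemma bestEdges_mono (hf : IsLogConcaveDensity f) (he : StrictMono e) (he' : StrictMono e')
    (h : e ≤ e') : bestEdges f b e ≤ bestEdges f b e' := fun k => by
  have h1 := hf.centroid_mono he he' h k.2.le
  have h2 := hf.centroid_mono he he' h (Nat.succ_le_of_lt k.2)
  simp only [bestEdges]
  linarith

lemma centroid_lt_add (hf : IsLogConcaveDensity f) (he : StrictMono e) (he' : StrictMono e')
    {δ : ℝ} (hδ : 0 < δ) (h : ∀ k, e k ≤ e' k + δ) {k : ℕ} (hk : k ≤ n) :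
    centroid f e k < centroid f e' k + δ := by
  refine lt_of_le_of_lt ?_ (hf.condMean_shift_lt (binEdge_lt_succ he' hk) hδ)
  refine hf.condMean_mono (binEdge_lt_succ he hk) ?_ (binEdge_le_add h _) (binEdge_le_add h _)
  exact EReal.add_lt_add_right_coe (binEdge_lt_succ he' hk) δ

/-- Comparison principle: subsolutions of the edge equations lie below supersolutions. -/
lemma le_of_le_bestEdges (hf : IsLogConcaveDensity f) (he : StrictMono e) (he' : StrictMono e')
    (hsub : e ≤ bestEdges f b e) (hsup : bestEdges f b e' ≤ e') : e ≤ e' := by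
  by_contra hcon
  obtain ⟨i, hi⟩ : ∃ i, e' i < e i := by
    simpa [Pi.le_def] using hcon
  have : Nonempty (Fin n) := ⟨i⟩
  obtain ⟨k, hk⟩ := Finite.exists_max (fun k => e k - e' k)
  have hδ : 0 < e k - e' k := by linarith [hk i]
  have hle : ∀ j, e j ≤ e' j + (e k - e' k) := fun j => by linarith [hk j]
  have h1 := hf.centroid_lt_add he he' hδ hle k.2.le
  have h2 := hf.centroid_lt_add he he' hδ hle (Nat.succ_le_of_lt k.2)
  have h3 := hsub k
  have h4 := hsup k
  simp only [bestEdges, Nat.succ_eq_add_one] at h1 h2 h3 h4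
  linarith

end IsLogConcaveDensity

namespace IsLogConcaveDensity

variable {f : ℝ → ℝ} {b : ℝ} {n : ℕ} {e e' : Fin n → ℝ}

lemma actionCost_centroid_le (hf : IsLogConcaveDensity f) (he : StrictMono e) (u : ℕ → ℝ) :
    actionCost f e (centroid f e) ≤ actionCost f e u := by
  refine Finset.sum_le_sum fun k hk => ?_
  have hlt := binEdge_lt_succ he (Nat.lt_succ_iff.1 (Finset.mem_range.1 hk))
  rw [hf.setIntegral_sub_sq_mul hlt (u k)]
  have := mul_nonneg (sq_nonneg (condMean f (ebin (binEdge e k) (binEdge e (k + 1))) - u k))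
    (hf.mass_pos hlt).le
  simp only [centroid]
  linarith

lemma actionCost_eq_sum (hf : IsLogConcaveDensity f) (he : StrictMono e) (u : ℕ → ℝ) :
    actionCost f e u = (∑ k ∈ Finset.range n,
      integralBelow (fun x => (u k - x) ^ 2 * f x - (u (k + 1) - x) ^ 2 * f x)
        (binEdge e (k + 1))) + integralBelow (fun x => (u n - x) ^ 2 * f x) ⊤ := by
  have h1 : actionCost f e u = ∑ k ∈ Finset.range (n + 1),
      (integralBelow (fun x => (u k - x) ^ 2 * f x) (binEdge e (k + 1))
        - integralBelow (fun x => (u k - x) ^ 2 * f x) (binEdge e k)) := by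
    refine Finset.sum_congr rfl fun k hk => ?_
    exact setIntegral_ebin (hf.integrable_sub_sq_mul _)
      (binEdge_lt_succ he (Nat.lt_succ_iff.1 (Finset.mem_range.1 hk))).le
  rw [h1, Finset.sum_sub_distrib, Finset.sum_range_succ, Finset.sum_range_succ', binEdge_zero,
    integralBelow_bot, binEdge_of_gt e (Nat.lt_succ_self n)]
  have h2 : ∀ k, integralBelow (fun x => (u k - x) ^ 2 * f x - (u (k + 1) - x) ^ 2 * f x)
        (binEdge e (k + 1))
      = integralBelow (fun x => (u k - x) ^ 2 * f x) (binEdge e (k + 1))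
        - integralBelow (fun x => (u (k + 1) - x) ^ 2 * f x) (binEdge e (k + 1)) := fun k =>
    integral_sub (hf.integrable_sub_sq_mul _).integrableOn
      (hf.integrable_sub_sq_mul _).integrableOn
  simp only [h2, Finset.sum_sub_distrib]
  ring

lemma actionCost_anti_edges (hf : IsLogConcaveDensity f) (he : StrictMono e)
    (he' : StrictMono e') (h : e ≤ e') {u : ℕ → ℝ} (hu : ∀ k < n, u k ≤ u (k + 1))
    (hmid : ∀ k : Fin n, e' k ≤ (u k + u (k + 1)) / 2) :
    actionCost f e' u ≤ actionCost f e u := by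
  rw [hf.actionCost_eq_sum he, hf.actionCost_eq_sum he']
  refine add_le_add_left (Finset.sum_le_sum fun k hk => ?_) _
  have hk' := Finset.mem_range.1 hk
  have hi : Integrable (fun x => (u k - x) ^ 2 * f x - (u (k + 1) - x) ^ 2 * f x) :=
    (hf.integrable_sub_sq_mul _).sub (hf.integrable_sub_sq_mul _)
  have h1 := setIntegral_ebin hi (binEdge_mono_le h (k + 1))
  have h2 : ∫ x in ebin (binEdge e (k + 1)) (binEdge e' (k + 1)),
      ((u k - x) ^ 2 * f x - (u (k + 1) - x) ^ 2 * f x) ≤ 0 := by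
    refine setIntegral_nonpos (measurableSet_ebin _ _) fun x hx => ?_
    have h3 := binEdge_succ e' ⟨k, hk'⟩
    simp only at h3
    have hx2 := hx.2
    rw [h3] at hx2
    have hx3 : x < e' ⟨k, hk'⟩ := by exact_mod_cast hx2
    have h4 := hmid ⟨k, hk'⟩
    simp only at h4
    have h5 := hu k hk'
    have h6 : (u k - x) ^ 2 - (u (k + 1) - x) ^ 2 ≤ 0 := by nlinarith
    nlinarith [hf.pos x]
  linarith

lemma actionCost_bestEdges_le (hf : IsLogConcaveDensity f) (hb : b ≤ 0) (he : StrictMono e)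
    (hsub : e ≤ bestEdges f b e) :
    actionCost f (bestEdges f b e) (centroid f (bestEdges f b e))
      ≤ actionCost f e (centroid f e) := by
  have hs : StrictMono (bestEdges f b e) := hf.strictMono_bestEdges he
  refine (hf.actionCost_centroid_le hs (centroid f e)).trans ?_
  refine hf.actionCost_anti_edges he hs hsub (fun k hk => (hf.centroid_lt_succ he hk).le)
    fun k => ?_
  simp only [bestEdges]
  linarith

lemma tendsto_centroid (hf : IsLogConcaveDensity f) {s : ℕ → Fin n → ℝ}
    (h : ∀ k, Filter.Tendsto (fun j => s j k) Filter.atTop (nhds (e k)))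
    (hs : ∀ j, StrictMono (s j)) {k : ℕ} (hk : k ≤ n) (hlt : binEdge e k < binEdge e (k + 1)) :
    Filter.Tendsto (fun j => centroid f (s j) k) Filter.atTop (nhds (centroid f e k)) :=
  (tendsto_setIntegral_binEdge hf.integrable_mul h hs hk hlt.le).div
    (tendsto_setIntegral_binEdge hf.integrable h hs hk hlt.le) (hf.mass_pos hlt).ne'

lemma setIntegral_sub_sq_mul_eq (hf : IsLogConcaveDensity f) (s : Set ℝ) (w : ℝ) :
    ∫ x in s, (w - x) ^ 2 * f x
      = (∫ x in s, x ^ 2 * f x) - 2 * w * (∫ x in s, x * f x) + w ^ 2 * ∫ x in s, f x := by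
  rw [← integral_const_mul, ← integral_const_mul, ← integral_sub, ← integral_add]
  · congr 1
    funext x
    ring
  · exact (hf.integrable_sq_mul.sub (hf.integrable_mul.const_mul _)).integrableOn
  · exact (hf.integrable.const_mul _).integrableOn
  · exact hf.integrable_sq_mul.integrableOn
  · exact (hf.integrable_mul.const_mul _).integrableOn

lemma tendsto_actionCost (hf : IsLogConcaveDensity f) (he : StrictMono e) {s : ℕ → Fin n → ℝ}
    (h : ∀ k, Filter.Tendsto (fun j => s j k) Filter.atTop (nhds (e k)))
    (hs : ∀ j, StrictMono (s j)) :
    Filter.Tendsto (fun j => actionCost f (s j) (centroid f (s j))) Filter.atTop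
      (nhds (actionCost f e (centroid f e))) := by
  refine tendsto_finsetSum _ fun k hk => ?_
  have hk' := Nat.lt_succ_iff.1 (Finset.mem_range.1 hk)
  have hlt := binEdge_lt_succ he hk'
  have hc := hf.tendsto_centroid h hs hk' hlt
  simp only [hf.setIntegral_sub_sq_mul_eq]
  exact ((tendsto_setIntegral_binEdge hf.integrable_sq_mul h hs hk' hlt.le).sub
    ((hc.const_mul 2).mul (tendsto_setIntegral_binEdge hf.integrable_mul h hs hk' hlt.le))).add
    ((hc.pow 2).mul (tendsto_setIntegral_binEdge hf.integrable h hs hk' hlt.le))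

/-- Limits of increasing nearest-neighbor iterations with nonpositive bias are nondegenerate
equilibria. -/
lemma limit_isEquilibrium (hf : IsLogConcaveDensity f) (hb : b ≤ 0) {s : ℕ → Fin n → ℝ}
    (h : ∀ k, Filter.Tendsto (fun j => s j k) Filter.atTop (nhds (e k)))
    (hs : ∀ j, StrictMono (s j)) (hstep : ∀ j, s (j + 1) = bestEdges f b (s j))
    (hmono : Monotone s) (he' : StrictMono e') (hbound : ∀ j, s j ≤ e') :
    StrictMono e ∧ e = bestEdges f b e := by
  have hU : ∀ k : ℕ, ∃ U : ℝ, k ≤ n →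
      Filter.Tendsto (fun j => centroid f (s j) k) Filter.atTop (nhds U) := by
    intro k
    by_cases hk : k ≤ n
    · refine ⟨_, fun _ => tendsto_atTop_ciSup
        (fun i j hij => hf.centroid_mono (hs i) (hs j) (hmono hij) hk)
        ⟨centroid f e' k, ?_⟩⟩
      rintro _ ⟨j, rfl⟩
      exact hf.centroid_mono (hs j) he' (hbound j) hk
    · exact ⟨0, fun h => absurd h hk⟩
  choose U hU using hU
  have hedge : ∀ k : Fin n, e k = (U k + U (k + 1)) / 2 + b := by
    intro k
    have h1 := (h k).comp (Filter.tendsto_add_atTop_nat 1)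
    refine tendsto_nhds_unique h1 ?_
    have h2 := (((hU k k.2.le).add (hU (k + 1) k.2)).div_const 2).add_const b
    refine h2.congr fun j => ?_
    simp [hstep, bestEdges]
  have hle : ∀ k : Fin n, e k ≤ U (k + 1) := fun k =>
    le_of_tendsto_of_tendsto' (h k) (hU (k + 1) k.2) fun j => (hf.edge_lt_centroid (hs j) k).le
  have hge : ∀ k : Fin n, U k ≤ e k := fun k =>
    le_of_tendsto_of_tendsto' (hU k k.2.le) (h k) fun j => (hf.centroid_lt_edge (hs j) k).le
  have hlt : ∀ k ≤ n, binEdge e k < binEdge e (k + 1) := by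
    intro k
    induction k with
    | zero =>
      intro _
      rw [binEdge_zero]
      refine binEdge_cases e (p := fun k z => 0 < k → ⊥ < z) (fun h => absurd h (lt_irrefl 0))
        (fun k _ => EReal.bot_lt_coe _) (fun _ _ _ => bot_lt_top) (0 + 1) Nat.one_pos
    | succ k ih =>
      intro hk
      have h1 := binEdge_succ e ⟨k, hk⟩
      simp only at h1
      rcases Nat.lt_or_ge (k + 1) n with h3 | h3
      · have h2 := binEdge_succ e ⟨k + 1, h3⟩
        simp only at h2
        have hbin := ih (by omega)
        have hUk : U k = centroid f e k :=
          tendsto_nhds_unique (hU k (by omega)) (hf.tendsto_centroid h hs (by omega) hbin)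
        have hc : centroid f e k < e ⟨k, hk⟩ := by
          rw [h1] at hbin
          rw [centroid, h1]
          exact hf.condMean_lt hbin
        rw [h1, h2]
        by_contra hcon
        have hcon' : e ⟨k + 1, h3⟩ ≤ e ⟨k, hk⟩ := by exact_mod_cast not_lt.1 hcon
        have a1 := hge ⟨k + 1, h3⟩
        have a2 := hedge ⟨k, hk⟩
        simp only at a1 a2
        linarith
      · rw [h1, binEdge_of_gt e (by omega)]
        exact EReal.coe_lt_top _
  constructor
  · rcases n with _ | n
    · exact fun i => i.elim0
    refine Fin.strictMono_iff_lt_succ.2 fun i => ?_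
    have h1 := hlt (i + 1) (by omega)
    have h2 := binEdge_succ e i.castSucc
    have h3 := binEdge_succ e i.succ
    simp only [Fin.val_castSucc, Fin.val_succ] at h2 h3
    rw [h2, h3] at h1
    exact_mod_cast h1
  · funext k
    have h1 := tendsto_nhds_unique (hU k k.2.le) (hf.tendsto_centroid h hs k.2.le (hlt _ k.2.le))
    have h2 := tendsto_nhds_unique (hU (k + 1) k.2) (hf.tendsto_centroid h hs k.2 (hlt _ k.2))
    rw [hedge k, h1, h2, bestEdges]

/-- For nonpositive bias, an equilibrium costs at most as much as any subsolution of its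
edge equations. -/
lemma actionCost_le_of_le_bestEdges (hf : IsLogConcaveDensity f) (hb : b ≤ 0)
    (he : StrictMono e) (hsub : e ≤ bestEdges f b e) (he' : StrictMono e')
    (heq : e' = bestEdges f b e') :
    actionCost f e' (centroid f e') ≤ actionCost f e (centroid f e) := by
  set s : ℕ → Fin n → ℝ := fun j => (bestEdges f b)^[j] e with hs_def
  have hstep : ∀ j, s (j + 1) = bestEdges f b (s j) := fun j =>
    Function.iterate_succ_apply' _ _ _
  have hs : ∀ j, StrictMono (s j) ∧ s j ≤ bestEdges f b (s j) := by
    intro j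
    induction j with
    | zero => exact ⟨he, hsub⟩
    | succ j ih =>
      rw [hstep]
      have h1 : StrictMono (bestEdges f b (s j)) := hf.strictMono_bestEdges ih.1
      exact ⟨h1, hf.bestEdges_mono ih.1 h1 ih.2⟩
  have hmono : Monotone s := monotone_nat_of_le_succ fun j => by
    rw [hstep]
    exact (hs j).2
  have hbound : ∀ j, s j ≤ e' := fun j =>
    hf.le_of_le_bestEdges (hs j).1 he' (hs j).2 heq.ge
  have hlim : ∀ k, Filter.Tendsto (fun j => s j k) Filter.atTop (nhds (⨆ j, s j k)) := fun k =>
    tendsto_atTop_ciSup (fun i j hij => hmono hij k) ⟨e' k, by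
      rintro _ ⟨j, rfl⟩
      exact hbound j k⟩
  obtain ⟨h1, h2⟩ := hf.limit_isEquilibrium hb hlim (fun j => (hs j).1) hstep hmono he' hbound
  have h3 : e' = fun k => ⨆ j, s j k :=
    le_antisymm (hf.le_of_le_bestEdges he' h1 heq.le h2.ge)
      (hf.le_of_le_bestEdges h1 he' h2.le heq.ge)
  rw [h3]
  have hanti : Antitone fun j => actionCost f (s j) (centroid f (s j)) :=
    antitone_nat_of_succ_le fun j => by
      rw [hstep]
      exact hf.actionCost_bestEdges_le hb (hs j).1 (hs j).2
  exact hanti.le_of_tendsto (hf.tendsto_actionCost h1 hlim fun j => (hs j).1) 0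

end IsLogConcaveDensity

lemma binEdge_cons_one {n : ℕ} (e : Fin n → ℝ) (t : ℝ) :
    binEdge (Fin.cons t e : Fin (n + 1) → ℝ) 1 = t :=
  binEdge_succ (Fin.cons t e : Fin (n + 1) → ℝ) 0

lemma binEdge_cons_add_two {n : ℕ} (e : Fin n → ℝ) (t : ℝ) (k : ℕ) :
    binEdge (Fin.cons t e : Fin (n + 1) → ℝ) (k + 2) = binEdge e (k + 1) := by
  by_cases hk : k < n
  · have h1 := binEdge_succ e ⟨k, hk⟩
    have h2 := binEdge_succ (Fin.cons t e : Fin (n + 1) → ℝ) (Fin.succ ⟨k, hk⟩)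
    rw [Fin.cons_succ] at h2
    exact h2.trans h1.symm
  · rw [binEdge_of_gt e (by omega), binEdge_of_gt _ (by omega)]

lemma strictMono_cons {n : ℕ} {e : Fin n → ℝ} (he : StrictMono e) {t : ℝ}
    (ht : (t : EReal) < binEdge e 1) : StrictMono (Fin.cons t e : Fin (n + 1) → ℝ) := by
  refine Fin.strictMono_iff_lt_succ.2 fun i => ?_
  rcases n with _ | n
  · exact i.elim0
  rw [Fin.cons_succ]
  induction i using Fin.cases with
  | zero =>
    have h := binEdge_succ e 0
    simp only [Fin.val_zero, zero_add] at h
    rw [h] at ht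
    exact_mod_cast ht
  | succ i =>
    have : (i.succ).castSucc = i.castSucc.succ := rfl
    rw [this, Fin.cons_succ]
    exact he (Fin.castSucc_lt_succ)

namespace IsLogConcaveDensity

variable {f : ℝ → ℝ} {b : ℝ} {n : ℕ} {e e' : Fin n → ℝ}

lemma split_cost_lt (hf : IsLogConcaveDensity f) {lo hi : EReal} {t : ℝ} (h : lo < t)
    (h' : t < hi) :
    (∫ x in ebin t hi, (condMean f (ebin t hi) - x) ^ 2 * f x)
      + (∫ x in ebin lo t, (condMean f (ebin lo t) - x) ^ 2 * f x)
      < ∫ x in ebin lo hi, (condMean f (ebin lo hi) - x) ^ 2 * f x := by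
  set w := condMean f (ebin lo hi)
  rw [setIntegral_ebin_add (hf.integrable_sub_sq_mul w) h.le h'.le,
    hf.setIntegral_sub_sq_mul h w, hf.setIntegral_sub_sq_mul h' w]
  have m1 := hf.mass_pos h
  have m2 := hf.mass_pos h'
  have c1 := hf.condMean_lt h
  have c2 := hf.lt_condMean h'
  rcases le_or_gt w t with hw | hw
  · have p1 := mul_pos (pow_pos (show 0 < condMean f (ebin t hi) - w by linarith) 2) m2
    have p2 := mul_nonneg (sq_nonneg (condMean f (ebin lo t) - w)) m1.le
    linarith
  · have p1 := mul_pos (sq_pos_of_neg (show condMean f (ebin lo t) - w < 0 by linarith)) m1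
    have p2 := mul_nonneg (sq_nonneg (condMean f (ebin t hi) - w)) m2.le
    linarith

lemma actionCost_cons_lt (hf : IsLogConcaveDensity f) {t : ℝ}
    (ht : (t : EReal) < binEdge e 1) :
    actionCost f (Fin.cons t e : Fin (n + 1) → ℝ) (centroid f (Fin.cons t e : Fin (n + 1) → ℝ))
      < actionCost f e (centroid f e) := by
  rw [actionCost, actionCost, Finset.sum_range_succ', Finset.sum_range_succ',
    Finset.sum_range_succ', add_assoc]
  have h := hf.split_cost_lt (EReal.bot_lt_coe t) ht
  have h1 : ∀ k, binEdge (Fin.cons t e : Fin (n + 1) → ℝ) (k + 1 + 1) = binEdge e (k + 1) :=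
    binEdge_cons_add_two e t
  simp only [centroid, zero_add, Nat.reduceAdd, h1, binEdge_cons_one, binEdge_zero]
  exact add_lt_add_right h _

lemma exists_cons_le_bestEdges (hf : IsLogConcaveDensity f) (he : StrictMono e)
    (heq : e = bestEdges f b e) :
    ∃ t : ℝ, (t : EReal) < binEdge e 1 ∧ (Fin.cons t e : Fin (n + 1) → ℝ)
      ≤ bestEdges f b (Fin.cons t e : Fin (n + 1) → ℝ) := by
  have hE : ⊥ < binEdge e 1 := by
    have := binEdge_lt_succ he (Nat.zero_le n)
    rwa [binEdge_zero] at this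
  obtain ⟨r, -, hr⟩ := EReal.lt_iff_exists_real_btwn.1 hE
  set c0 := condMean f (ebin ⊥ (0 : ℝ)) with hc0
  set c1 := condMean f (ebin ⊥ (binEdge e 1)) with hc1
  set t := min r (min (-1) (c0 + c1 + 2 * b)) with ht
  have ht1 : t ≤ r := min_le_left _ _
  have ht2 : t ≤ -1 := (min_le_right _ _).trans (min_le_left _ _)
  have ht3 : t ≤ c0 + c1 + 2 * b := (min_le_right _ _).trans (min_le_right _ _)
  have htE : (t : EReal) < binEdge e 1 := lt_of_le_of_lt (by exact_mod_cast ht1) hr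
  have hmono := strictMono_cons he htE
  refine ⟨t, htE, fun k => ?_⟩
  induction k using Fin.cases with
  | zero =>
    have h1 := hf.condMean_shift_lt (EReal.bot_lt_coe t) (δ := -t) (by linarith)
    rw [EReal.bot_add, ← EReal.coe_add, add_neg_cancel, ← hc0] at h1
    have h2 := hf.condMean_mono hE htE bot_le le_rfl
    simp only [Fin.cons_zero, bestEdges, centroid, Fin.val_zero, zero_add, binEdge_zero,
      binEdge_cons_one, Nat.reduceAdd, binEdge_cons_add_two e t 0]
    linarith
  | succ i =>
    have h1 := congrFun heq i
    have h2 : centroid f e i ≤ centroid f (Fin.cons t e : Fin (n + 1) → ℝ) (i + 1) := by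
      refine hf.condMean_mono (binEdge_lt_succ he i.2.le)
        (binEdge_lt_succ hmono (by omega)) ?_ (binEdge_cons_add_two e t i).ge
      rcases hi : (i : ℕ) with _ | k
      · rw [binEdge_zero]
        exact bot_le
      · exact (binEdge_cons_add_two e t k).ge
    have h3 : centroid f (Fin.cons t e : Fin (n + 1) → ℝ) (i + 1 + 1) = centroid f e (i + 1) := by
      rw [centroid, centroid, binEdge_cons_add_two]
      exact congrArg (fun z => condMean f (ebin _ z)) (binEdge_cons_add_two e t (i + 1))
    rw [Fin.cons_succ, h1]
    simp only [bestEdges, Fin.val_succ, h3]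
    linarith

lemma decoderCost_lt_of_nonpos (hf : IsLogConcaveDensity f) (hb : b ≤ 0)
    (e : Fin n → ℝ) (e' : Fin (n + 1) → ℝ) (he : IsEq2 f b (n + 1) e)
    (he' : IsEq2 f b (n + 2) e') :
    decoderCost f (n + 2) e' < decoderCost f (n + 1) e := by
  rw [isEq2_succ_iff] at he
  have h2 : StrictMono e' ∧ ∀ k, e' k = bestEdges f b e' k := he'
  obtain ⟨t, ht, hsub⟩ := hf.exists_cons_le_bestEdges he.1 (funext he.2)
  refine lt_of_le_of_lt ?_ ((hf.actionCost_cons_lt ht).trans_eq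
    (decoderCost_eq_actionCost f e).symm)
  exact (decoderCost_eq_actionCost f e').trans_le
    (hf.actionCost_le_of_le_bestEdges hb (strictMono_cons he.1 ht) hsub h2.1 (funext h2.2))

end IsLogConcaveDensity

section Reflection

variable (f : ℝ → ℝ) {b : ℝ} {n : ℕ} (e : Fin n → ℝ)

lemma condMean_comp_neg (lo hi : EReal) :
    condMean (fun x => f (-x)) (ebin (-hi) (-lo)) = -condMean f (ebin lo hi) := by
  rw [condMean, condMean, setIntegral_ebin_neg (fun x => x * f (-x)),
    setIntegral_ebin_neg (fun x => f (-x))]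
  simp only [neg_neg, neg_mul, integral_neg, neg_div]

lemma binEdge_reflect {k : ℕ} (hk : k ≤ n + 1) :
    binEdge (fun i => -e (Fin.rev i)) k = -binEdge e (n + 1 - k) := by
  refine binEdge_cases (fun i => -e (Fin.rev i))
    (p := fun k z => k ≤ n + 1 → z = -binEdge e (n + 1 - k)) (fun _ => ?_) (fun i _ => ?_)
    (fun k hk hk' => ?_) k hk
  · rw [binEdge_of_gt e (by omega), EReal.neg_top]
  · have h := binEdge_succ e (Fin.rev i)
    rw [Fin.val_rev] at h
    rw [show n + 1 - (i + 1 : ℕ) = n - (i + 1) + 1 by omega, h, EReal.coe_neg]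
  · rw [show n + 1 - k = 0 by omega, binEdge_zero, EReal.neg_bot]

lemma centroid_reflect {k : ℕ} (hk : k ≤ n) :
    centroid (fun x => f (-x)) (fun i => -e (Fin.rev i)) k = -centroid f e (n - k) := by
  rw [centroid, centroid, binEdge_reflect e (by omega), binEdge_reflect e (by omega),
    condMean_comp_neg, show n + 1 - (k + 1) = n - k by omega,
    show n + 1 - k = n - k + 1 by omega]

variable {f e}

lemma isEq2_reflect (h : IsEq2 f b (n + 1) e) :
    IsEq2 (fun x => f (-x)) (-b) (n + 1) (fun i : Fin n => -e (Fin.rev i)) := by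
  rw [isEq2_succ_iff] at h ⊢
  refine ⟨fun i j hij => neg_lt_neg (h.1 (Fin.rev_lt_rev.2 hij)), fun k => ?_⟩
  have h1 := h.2 (Fin.rev k)
  have hk := k.2
  simp only [bestEdges, Fin.val_rev] at h1 ⊢
  rw [centroid_reflect f e hk.le, centroid_reflect f e hk, h1,
    show n - (k + 1 : ℕ) + 1 = n - k by omega]
  ring

variable (f e)

lemma decoderCost_reflect :
    decoderCost (fun x => f (-x)) (n + 1) (fun i : Fin n => -e (Fin.rev i))
      = decoderCost f (n + 1) e := by
  refine (decoderCost_eq_actionCost _ _).trans (Eq.trans ?_ (decoderCost_eq_actionCost f e).symm)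
  rw [actionCost, actionCost, ← Finset.sum_range_reflect]
  refine Finset.sum_congr rfl fun k hk => ?_
  have hk' := Finset.mem_range.1 hk
  rw [show n + 1 - 1 - k = n - k by omega, centroid_reflect f e (by omega),
    binEdge_reflect e (by omega), binEdge_reflect e (by omega), setIntegral_ebin_neg,
    show n + 1 - (n - k + 1) = k by omega, show n + 1 - (n - k) = k + 1 by omega,
    show n - (n - k) = k by omega]
  congr 1
  funext x
  rw [neg_neg]
  ring

end Reflection

/-- For an everywhere positive, strictly log-concave density with finite mean,
the decoder cost of the (unique) `(N+1)`-bin equilibrium is strictly smaller than that of the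
(unique) `N`-bin equilibrium, for every `N ≥ 1`: more bins are more informative. -/
theorem logConcave_more_bins_more_informative (f : ℝ → ℝ) (b : ℝ)
    (hpos : ∀ x, 0 < f x)
    (hint : Integrable f)
    (hpdf : ∫ x, f x = 1)
    (hslc : StrictConcaveOn ℝ Set.univ (fun x => Real.log (f x)))
    (hmean : Integrable (fun x => x * f x)) :
    ∀ N : ℕ, 1 ≤ N → ∀ (mN : Fin (N - 1) → ℝ) (mN1 : Fin (N + 1 - 1) → ℝ),
      IsEq2 f b N mN → IsEq2 f b (N + 1) mN1 →
      decoderCost f (N + 1) mN1 < decoderCost f N mN := by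
  intro N hN mN mN1 h h1
  have hf : IsLogConcaveDensity f := ⟨hpos, hint, hslc, hmean⟩
  obtain ⟨n, rfl⟩ : ∃ n, N = n + 1 := ⟨N - 1, by omega⟩
  rcases le_total b 0 with hb | hb
  · exact hf.decoderCost_lt_of_nonpos hb mN mN1 h h1
  · have := hf.comp_neg.decoderCost_lt_of_nonpos (neg_nonpos.2 hb) _ _
      (isEq2_reflect (n := n) h) (isEq2_reflect (n := n + 1) h1)
    rwa [decoderCost_reflect (n := n) f mN, decoderCost_reflect (n := n + 1) f mN1] at this
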